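/- Let D be a triangulated category with small coproducts, H a full subcategory of compact objects, and (A, B) an m-structure on the subcategory generated by H with A consisting of compact objects (A ⊥ B, A and B triangulated subcategories, and H ⊆ Ext¹(B, A)). Then (Ext^∞(A), Ext^∞(B)) satisfies orthogonality, shift-invariance, and decomposes Ext^∞(H), i.e., forms an m-structure on Ext^∞(H). -/

import Mathlib

open CategoryTheory Category Limits Pretriangulated DirectSum

universe v u

variable {D : Type u} [Category.{v} D] [HasZeroObject D] [Preadditive D] [HasShift D ℤ]
    [∀ n : ℤ, (shiftFunctor D n).Additive] [Pretriangulated D]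

/-- `Ext¹(B, A)`: objects `d` fitting into a distinguished triangle `a → d → b → a[1]`
with `a ∈ A`, `b ∈ B`. -/
def ext1Pair (B A : Set D) : Set D :=
  {d | ∃ (a b : D) (_ : a ∈ A) (_ : b ∈ B)
    (f : a ⟶ d) (g : d ⟶ b) (h : b ⟶ a⟦(1 : ℤ)⟧),
    Triangle.mk f g h ∈ distTriang D}

/-- `Ext¹(S) = Ext¹(S, S)`. -/
def ext1 (S : Set D) : Set D := ext1Pair S S

/-- `Extⁿ(S)`, iterated extensions. -/
def extN (S : Set D) : ℕ → Set D
  | 0 => S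
  | n + 1 => ext1 (extN S n)

/-- `Ext(S) = ∪_{n ≥ 1} Extⁿ(S)`. -/
def extAll (S : Set D) : Set D := ⋃ n : ℕ, extN S (n + 1)

/-- `S^∞`: small coproducts of objects of `S`. -/
def coprodClosure [HasCoproducts.{v} D] (S : Set D) : Set D :=
  {d | ∃ (I : Type v) (b : I → D), (∀ i, b i ∈ S) ∧ Nonempty (d ≅ ∐ b)}

/-- `Ext^∞(S) := Ext(S^∞)`. -/
def extInfty [HasCoproducts.{v} D] (S : Set D) : Set D := extAll (coprodClosure S)

/-- An object `a` is compact if `Hom(a, −)` commutes with small coproducts. -/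
def IsCompactObj [HasCoproducts.{v} D] (a : D) : Prop :=
  ∀ ⦃I : Type v⦄ (b : I → D),
    letI : DecidableEq I := Classical.decEq I
    Function.Bijective
      (DirectSum.toAddMonoid
        (fun i => AddMonoidHom.mk' (fun f : a ⟶ b i => f ≫ Sigma.ι b i)
          (fun f g => by simp [Preadditive.add_comp])) :
        (⨁ i, (a ⟶ b i)) →+ (a ⟶ ∐ b))


namespace Stmt7Aux

set_option linter.unusedSectionVars false

lemma dist_iso₃ {X Y Z Z' : D} {f : X ⟶ Y} {g : Y ⟶ Z} {h : Z ⟶ X⟦(1 : ℤ)⟧}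
    (hT : Triangle.mk f g h ∈ distTriang D) (e : Z ≅ Z') :
    Triangle.mk f (g ≫ e.hom) (e.inv ≫ h) ∈ distTriang D := by
  refine isomorphic_distinguished _ hT _ ?_
  exact Triangle.isoMk _ _ (Iso.refl _) (Iso.refl _) e.symm
    ((comp_id f).trans (id_comp f).symm)
    (show (g ≫ e.hom) ≫ e.inv = 𝟙 Y ≫ g by simp)
    (show (e.inv ≫ h) ≫ (𝟙 X)⟦(1 : ℤ)⟧' = e.inv ≫ h by simp)

lemma dist_iso₂ {X Y Z Y' : D} {f : X ⟶ Y} {g : Y ⟶ Z} {h : Z ⟶ X⟦(1 : ℤ)⟧}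
    (hT : Triangle.mk f g h ∈ distTriang D) (e : Y ≅ Y') :
    Triangle.mk (f ≫ e.hom) (e.inv ≫ g) h ∈ distTriang D := by
  refine isomorphic_distinguished _ hT _ ?_
  exact Triangle.isoMk _ _ (Iso.refl _) e.symm (Iso.refl _)
    (show (f ≫ e.hom) ≫ e.inv = 𝟙 X ≫ f by simp)
    (show (e.inv ≫ g) ≫ 𝟙 Z = e.inv ≫ g by simp)
    (show h ≫ (𝟙 X)⟦(1 : ℤ)⟧' = 𝟙 Z ≫ h by simp)

section exact

variable {X Y Z F : D} {f : X ⟶ Y} {g : Y ⟶ Z} {h : Z ⟶ X⟦(1 : ℤ)⟧}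

lemma yo2 (hT : Triangle.mk f g h ∈ distTriang D) (u : Y ⟶ F) (hu : f ≫ u = 0) :
    ∃ w : Z ⟶ F, u = g ≫ w := Triangle.yoneda_exact₂ _ hT u hu

lemma yo3 (hT : Triangle.mk f g h ∈ distTriang D) (u : Z ⟶ F) (hu : g ≫ u = 0) :
    ∃ w : X⟦(1 : ℤ)⟧ ⟶ F, u = h ≫ w := Triangle.yoneda_exact₃ _ hT u hu

lemma yo4 (hT : Triangle.mk f g h ∈ distTriang D) (u : X⟦(1 : ℤ)⟧ ⟶ F) (hu : h ≫ u = 0) :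
    ∃ w : Y⟦(1 : ℤ)⟧ ⟶ F, u = f⟦(1 : ℤ)⟧' ≫ w := by
  obtain ⟨w, hw⟩ : ∃ w : Y⟦(1 : ℤ)⟧ ⟶ F, u = (-f⟦(1 : ℤ)⟧') ≫ w :=
    Triangle.yoneda_exact₃ _ (rot_of_distTriang _ hT) u hu
  exact ⟨-w, by rw [hw]; simp⟩

lemma yo5 (hT : Triangle.mk f g h ∈ distTriang D) (u : Y⟦(1 : ℤ)⟧ ⟶ F)
    (hu : f⟦(1 : ℤ)⟧' ≫ u = 0) :
    ∃ w : Z⟦(1 : ℤ)⟧ ⟶ F, u = g⟦(1 : ℤ)⟧' ≫ w := by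
  obtain ⟨w, hw⟩ : ∃ w : Z⟦(1 : ℤ)⟧ ⟶ F, u = (-g⟦(1 : ℤ)⟧') ≫ w :=
    Triangle.yoneda_exact₃ _ (rot_of_distTriang _ (rot_of_distTriang _ hT)) u
      (show (-f⟦(1 : ℤ)⟧') ≫ u = 0 by rw [Preadditive.neg_comp, hu, neg_zero])
  exact ⟨-w, by rw [hw]; simp⟩

lemma co1 (hT : Triangle.mk f g h ∈ distTriang D) (u : F ⟶ X⟦(1 : ℤ)⟧)
    (hu : u ≫ f⟦(1 : ℤ)⟧' = 0) :
    ∃ w : F ⟶ Z, u = w ≫ h := Triangle.coyoneda_exact₁ _ hT u hu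

lemma co2 (hT : Triangle.mk f g h ∈ distTriang D) (u : F ⟶ Y) (hu : u ≫ g = 0) :
    ∃ w : F ⟶ X, u = w ≫ f := Triangle.coyoneda_exact₂ _ hT u hu

lemma co3 (hT : Triangle.mk f g h ∈ distTriang D) (u : F ⟶ Z) (hu : u ≫ h = 0) :
    ∃ w : F ⟶ Y, u = w ≫ g := Triangle.coyoneda_exact₃ _ hT u hu

lemma co4 (hT : Triangle.mk f g h ∈ distTriang D) (u : F ⟶ Y⟦(1 : ℤ)⟧)
    (hu : u ≫ g⟦(1 : ℤ)⟧' = 0) :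
    ∃ w : F ⟶ X⟦(1 : ℤ)⟧, u = w ≫ f⟦(1 : ℤ)⟧' := by
  obtain ⟨w, hw⟩ : ∃ w : F ⟶ X⟦(1 : ℤ)⟧, u = w ≫ (-f⟦(1 : ℤ)⟧') :=
    Triangle.coyoneda_exact₃ _ (rot_of_distTriang _ (rot_of_distTriang _ hT)) u
      (show u ≫ (-g⟦(1 : ℤ)⟧') = 0 by rw [Preadditive.comp_neg, hu, neg_zero])
  exact ⟨-w, by rw [hw]; simp⟩

lemma extend1 (hT : Triangle.mk f g h ∈ distTriang D) (u : X ⟶ F)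
    (hu : h ≫ u⟦(1 : ℤ)⟧' = 0) : ∃ w : Y ⟶ F, f ≫ w = u := by
  obtain ⟨w, hw, -⟩ := complete_distinguished_triangle_morphism₂ _ _ hT
    (contractible_distinguished F) u 0 (hu.trans zero_comp.symm)
  exact ⟨w, hw.trans (comp_id _)⟩

end exact

lemma ext1Pair_iso {P Q : Set D} {d d' : D} (e : d ≅ d') (hd : d ∈ ext1Pair Q P) :
    d' ∈ ext1Pair Q P := by
  obtain ⟨a, b, ha, hb, f, g, h, hT⟩ := hd
  exact ⟨a, b, ha, hb, _, _, _, dist_iso₂ hT e⟩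

lemma ext1Pair_mono {P P' Q Q' : Set D} (hP : P ⊆ P') (hQ : Q ⊆ Q') :
    ext1Pair Q P ⊆ ext1Pair Q' P' := by
  rintro d ⟨a, b, ha, hb, f, g, h, hT⟩
  exact ⟨a, b, hP ha, hQ hb, f, g, h, hT⟩

lemma ext1Pair_shift {P Q : Set D} (n : ℤ) (hP : ∀ a ∈ P, a⟦n⟧ ∈ P) (hQ : ∀ a ∈ Q, a⟦n⟧ ∈ Q) :
    ∀ d ∈ ext1Pair Q P, d⟦n⟧ ∈ ext1Pair Q P := by
  rintro d ⟨a, b, ha, hb, f, g, h, hT⟩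
  exact ⟨_, _, hP a ha, hQ b hb, _, _, _, Triangle.shift_distinguished _ hT n⟩

lemma extN_shift {S : Set D} (n : ℤ) (hS : ∀ a ∈ S, a⟦n⟧ ∈ S) (k : ℕ) :
    ∀ d ∈ extN S k, d⟦n⟧ ∈ extN S k := by
  induction k with
  | zero => exact hS
  | succ k ih => exact ext1Pair_shift n ih ih

lemma extAll_shift {S : Set D} (n : ℤ) (hS : ∀ a ∈ S, a⟦n⟧ ∈ S) :
    ∀ d ∈ extAll S, d⟦n⟧ ∈ extAll S := by
  intro d hd
  obtain ⟨k, hk⟩ := Set.mem_iUnion.1 hd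
  exact Set.mem_iUnion.2 ⟨k, extN_shift n hS _ d hk⟩

/-- membership of zero in `extN` and monotonicity -/
lemma extN_step {S : Set D} {z : D} (hz : IsZero z) (hzS : z ∈ S) (k : ℕ) :
    z ∈ extN S k ∧ extN S k ⊆ extN S (k + 1) := by
  have key : ∀ T : Set D, z ∈ T → T ⊆ ext1 T := by
    intro T hzT d hd
    exact ⟨d, z, hd, hzT, 𝟙 d, 0 ≫ (hz.isoZero.symm).hom, hz.isoZero.symm.inv ≫ 0,
      dist_iso₃ (contractible_distinguished d) hz.isoZero.symm⟩
  induction k with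
  | zero => exact ⟨hzS, key _ hzS⟩
  | succ k ih => exact ⟨ih.2 ih.1, key _ (ih.2 ih.1)⟩

lemma extN_mono {S : Set D} {z : D} (hz : IsZero z) (hzS : z ∈ S) : Monotone (extN S) :=
  monotone_nat_of_le_succ fun k => (extN_step hz hzS k).2

lemma ext1_extAll {S : Set D} {z : D} (hz : IsZero z) (hzS : z ∈ S) :
    ext1 (extAll S) ⊆ extAll S := by
  rintro d ⟨a, b, ha, hb, f, g, h, hT⟩
  obtain ⟨k, hk⟩ := Set.mem_iUnion.1 ha
  obtain ⟨l, hl⟩ := Set.mem_iUnion.1 hb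
  refine Set.mem_iUnion.2 ⟨max k l + 1, a, b, ?_, ?_, f, g, h, hT⟩
  · exact extN_mono hz hzS (by omega) hk
  · exact extN_mono hz hzS (by omega) hl

lemma subset_extAll {S : Set D} {z : D} (hz : IsZero z) (hzS : z ∈ S) : S ⊆ extAll S :=
  fun _ hd => Set.mem_iUnion.2 ⟨0, extN_mono hz hzS (Nat.zero_le 1) hd⟩

lemma extN_subset {S Q : Set D} (h : S ⊆ Q) (hQ : ext1 Q ⊆ Q) (k : ℕ) : extN S k ⊆ Q := by
  induction k with
  | zero => exact h
  | succ k ih => exact (ext1Pair_mono ih ih).trans hQ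

lemma extAll_subset {S Q : Set D} (h : S ⊆ Q) (hQ : ext1 Q ⊆ Q) : extAll S ⊆ Q :=
  Set.iUnion_subset fun k => extN_subset h hQ _

section coprod

variable [HasCoproducts.{v} D]

lemma exists_zero_mem (S : Set D) : ∃ z, IsZero z ∧ z ∈ coprodClosure S := by
  refine ⟨∐ (fun i : PEmpty.{v+1} => (i.elim : D)), ?_, PEmpty, _, fun i => i.elim, ⟨Iso.refl _⟩⟩
  rw [IsZero.iff_id_eq_zero]
  exact Sigma.hom_ext _ _ (fun i => i.elim)

lemma coprodClosure_shift {S : Set D} (n : ℤ) (hS : ∀ a ∈ S, a⟦n⟧ ∈ S) :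
    ∀ d ∈ coprodClosure S, d⟦n⟧ ∈ coprodClosure S := by
  rintro d ⟨I, b, hb, ⟨e⟩⟩
  exact ⟨I, fun i => (b i)⟦n⟧, fun i => hS _ (hb i),
    ⟨(shiftFunctor D n).mapIso e ≪≫ PreservesCoproduct.iso (shiftFunctor D n) b⟩⟩

lemma shift_desc {I : Type v} (a : I → D) {F : D} (t : ∀ i, (a i)⟦(1 : ℤ)⟧ ⟶ F) :
    ∃ s : (∐ a)⟦(1 : ℤ)⟧ ⟶ F, ∀ i, (Sigma.ι a i)⟦(1 : ℤ)⟧' ≫ s = t i := by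
  refine ⟨inv (sigmaComparison (shiftFunctor D (1 : ℤ)) a) ≫ Sigma.desc t, fun i => ?_⟩
  rw [← ι_comp_sigmaComparison]
  simp

lemma shift_hom_ext {I : Type v} (a : I → D) {F : D} (s t : (∐ a)⟦(1 : ℤ)⟧ ⟶ F)
    (h : ∀ i, (Sigma.ι a i)⟦(1 : ℤ)⟧' ≫ s = (Sigma.ι a i)⟦(1 : ℤ)⟧' ≫ t) : s = t := by
  rw [← cancel_epi (sigmaComparison (shiftFunctor D (1 : ℤ)) a)]
  refine Sigma.hom_ext _ _ fun i => ?_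
  simpa [← assoc, ι_comp_sigmaComparison] using h i

lemma coprod_dist {I : Type v} (a d b : I → D) (f : ∀ i, a i ⟶ d i) (g : ∀ i, d i ⟶ b i)
    (h : ∀ i, b i ⟶ (a i)⟦(1 : ℤ)⟧) (hT : ∀ i, Triangle.mk (f i) (g i) (h i) ∈ distTriang D) :
    ∃ (g' : ∐ d ⟶ ∐ b) (h' : ∐ b ⟶ (∐ a)⟦(1 : ℤ)⟧),
      Triangle.mk (Limits.Sigma.map f) g' h' ∈ distTriang D := by
  obtain ⟨C, G, H, hC⟩ := distinguished_cocone_triangle (Limits.Sigma.map f)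
  have z12 : Limits.Sigma.map f ≫ G = 0 := comp_distTriang_mor_zero₁₂ _ hC
  have z31 : H ≫ (Limits.Sigma.map f)⟦(1 : ℤ)⟧' = 0 := comp_distTriang_mor_zero₃₁ _ hC
  have hc : ∀ i, ∃ c : b i ⟶ C, g i ≫ c = Sigma.ι d i ≫ G ∧
      h i ≫ (Sigma.ι a i)⟦(1 : ℤ)⟧' = c ≫ H := fun i =>
    complete_distinguished_triangle_morphism _ _ (hT i) hC (Sigma.ι a i) (Sigma.ι d i)
      (show f i ≫ Sigma.ι d i = Sigma.ι a i ≫ Limits.Sigma.map f by simp)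
  choose c hc1 hc2 using hc
  have hiso : IsIso (Sigma.desc c) := by
    rw [isIso_iff_coyoneda_map_bijective]
    intro F
    constructor
    · intro w₁ w₂ hw
      rw [← sub_eq_zero]
      have hw : ∀ i, c i ≫ (w₁ - w₂) = 0 := by
        intro i
        have := congrArg (fun q => Sigma.ι b i ≫ q) hw
        simpa [Preadditive.comp_sub, sub_eq_zero] using this
      generalize w₁ - w₂ = w at hw
      have hGw : G ≫ w = 0 := by
        refine Sigma.hom_ext _ _ fun i => ?_
        rw [← assoc, ← hc1, assoc, hw]; simp
      obtain ⟨t, ht⟩ : ∃ t, w = H ≫ t := yo3 hC w hGw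
      have hs : ∀ i, ∃ s : (d i)⟦(1 : ℤ)⟧ ⟶ F,
          (Sigma.ι a i)⟦(1 : ℤ)⟧' ≫ t = (f i)⟦(1 : ℤ)⟧' ≫ s := by
        intro i
        refine yo4 (hT i) _ ?_
        rw [← assoc, hc2, assoc, ← ht, hw]
      choose s hs using hs
      obtain ⟨s', hs'⟩ := shift_desc d s
      have : t = (Limits.Sigma.map f)⟦(1 : ℤ)⟧' ≫ s' := by
        refine shift_hom_ext a _ _ fun i => ?_
        rw [hs, ← hs', ← assoc, ← assoc, ← Functor.map_comp, ← Functor.map_comp]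
        simp
      rw [ht, this, ← assoc, z31, zero_comp]
    · intro u
      have hu : Limits.Sigma.map f ≫ Limits.Sigma.map g ≫ u = 0 := by
        refine Sigma.hom_ext _ _ fun i => ?_
        have : f i ≫ g i = 0 := comp_distTriang_mor_zero₁₂ _ (hT i)
        have h2 : f i ≫ g i ≫ Sigma.ι b i ≫ u = 0 := by
          rw [← assoc, this, zero_comp]
        simpa using h2
      obtain ⟨w, hw⟩ : ∃ w, Limits.Sigma.map g ≫ u = G ≫ w := yo2 hC _ hu
      have ht : ∀ i, ∃ t : (a i)⟦(1 : ℤ)⟧ ⟶ F, c i ≫ w - Sigma.ι b i ≫ u = h i ≫ t := by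
        intro i
        refine yo3 (hT i) _ ?_
        rw [Preadditive.comp_sub, ← assoc, hc1, assoc, ← hw]
        simp
      choose t ht using ht
      obtain ⟨s, hs⟩ := shift_desc a t
      refine ⟨w - H ≫ s, ?_⟩
      refine Sigma.hom_ext _ _ fun i => ?_
      have : c i ≫ H ≫ s = c i ≫ w - Sigma.ι b i ≫ u := by
        rw [ht, ← assoc, ← hc2, assoc, hs]
      simp [Preadditive.comp_sub, this]
  exact ⟨_, _, dist_iso₃ hC (asIso (Sigma.desc c)).symm⟩

end coprod

/-- five lemma for maps into `F` -/
lemma five_pre {F d₁ d d₂ b₁ b b₂ : D} {i : d₁ ⟶ d} {p : d ⟶ d₂} {δ : d₂ ⟶ d₁⟦(1 : ℤ)⟧}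
    {i' : b₁ ⟶ b} {p' : b ⟶ b₂} {δ' : b₂ ⟶ b₁⟦(1 : ℤ)⟧}
    (hT : Triangle.mk i p δ ∈ distTriang D) (hT' : Triangle.mk i' p' δ' ∈ distTriang D)
    {φ₁ : d₁ ⟶ b₁} {φ : d ⟶ b} {φ₂ : d₂ ⟶ b₂}
    (c₁ : i ≫ φ = φ₁ ≫ i') (c₂ : p ≫ φ₂ = φ ≫ p') (c₃ : δ ≫ φ₁⟦(1 : ℤ)⟧' = φ₂ ≫ δ')
    (hs1 : ∀ u : d₁ ⟶ F, ∃ v, φ₁ ≫ v = u) (hi1 : ∀ v : b₁ ⟶ F, φ₁ ≫ v = 0 → v = 0)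
    (hs2 : ∀ u : d₂ ⟶ F, ∃ v, φ₂ ≫ v = u) (hi2 : ∀ v : b₂ ⟶ F, φ₂ ≫ v = 0 → v = 0)
    (hi2' : ∀ v : b₂ ⟶ F⟦(1 : ℤ)⟧, φ₂ ≫ v = 0 → v = 0)
    (hs1' : ∀ u : d₁⟦(1 : ℤ)⟧ ⟶ F, ∃ v, φ₁⟦(1 : ℤ)⟧' ≫ v = u) :
    (∀ u : d ⟶ F, ∃ v, φ ≫ v = u) ∧ (∀ v : b ⟶ F, φ ≫ v = 0 → v = 0) := by
  have z12' : i' ≫ p' = 0 := comp_distTriang_mor_zero₁₂ _ hT'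
  have z23' : p' ≫ δ' = 0 := comp_distTriang_mor_zero₂₃ _ hT'
  have z31 : δ ≫ i⟦(1 : ℤ)⟧' = 0 := comp_distTriang_mor_zero₃₁ _ hT
  constructor
  · intro u
    obtain ⟨v₁, hv₁⟩ := hs1 (i ≫ u)
    have h0 : δ' ≫ v₁⟦(1 : ℤ)⟧' = 0 := by
      apply hi2'
      rw [← assoc, ← c₃, assoc, ← Functor.map_comp, hv₁, Functor.map_comp, ← assoc, z31, zero_comp]
    obtain ⟨v, hv⟩ := extend1 hT' v₁ h0
    obtain ⟨w, hw⟩ : ∃ w, u - φ ≫ v = p ≫ w := yo2 hT (u - φ ≫ v) (by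
      rw [Preadditive.comp_sub, ← assoc, c₁, assoc, hv, hv₁, sub_self])
    obtain ⟨w', rfl⟩ := hs2 w
    refine ⟨v + p' ≫ w', ?_⟩
    rw [Preadditive.comp_add, ← assoc, ← c₂, assoc, ← hw]
    abel
  · intro v hv
    have h1 : i' ≫ v = 0 := hi1 _ (by rw [← assoc, ← c₁, assoc, hv, comp_zero])
    obtain ⟨w, rfl⟩ : ∃ w, v = p' ≫ w := yo2 hT' v h1
    obtain ⟨t, ht⟩ : ∃ t, φ₂ ≫ w = δ ≫ t := yo3 hT (φ₂ ≫ w) (by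
      rw [← assoc, c₂, assoc, hv])
    obtain ⟨t', rfl⟩ := hs1' t
    have : w - δ' ≫ t' = 0 := hi2 _ (by
      rw [Preadditive.comp_sub, ht, ← assoc, c₃, assoc, sub_self])
    rw [sub_eq_zero.1 this, ← assoc, z23', zero_comp]

/-- five lemma for maps out of `x` -/
lemma five_post {x a₁ a a₂ d₁ d d₂ : D} {i : a₁ ⟶ a} {p : a ⟶ a₂} {δ : a₂ ⟶ a₁⟦(1 : ℤ)⟧}
    {i' : d₁ ⟶ d} {p' : d ⟶ d₂} {δ' : d₂ ⟶ d₁⟦(1 : ℤ)⟧}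
    (hT : Triangle.mk i p δ ∈ distTriang D) (hT' : Triangle.mk i' p' δ' ∈ distTriang D)
    {ψ₁ : a₁ ⟶ d₁} {ψ : a ⟶ d} {ψ₂ : a₂ ⟶ d₂}
    (c₁ : i ≫ ψ = ψ₁ ≫ i') (c₂ : p ≫ ψ₂ = ψ ≫ p') (c₃ : δ ≫ ψ₁⟦(1 : ℤ)⟧' = ψ₂ ≫ δ')
    (hs1 : ∀ u : x ⟶ d₁, ∃ v, v ≫ ψ₁ = u)
    (hs2 : ∀ u : x ⟶ d₂, ∃ v, v ≫ ψ₂ = u) (hi2 : ∀ v : x ⟶ a₂, v ≫ ψ₂ = 0 → v = 0)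
    (hi1' : ∀ v : x ⟶ a₁⟦(1 : ℤ)⟧, v ≫ ψ₁⟦(1 : ℤ)⟧' = 0 → v = 0)
    (hi1'' : ∀ v : x⟦(1 : ℤ)⟧ ⟶ a₁⟦(1 : ℤ)⟧, v ≫ ψ₁⟦(1 : ℤ)⟧' = 0 → v = 0)
    (hs2' : ∀ u : x⟦(1 : ℤ)⟧ ⟶ d₂, ∃ v, v ≫ ψ₂ = u) :
    (∀ u : x ⟶ d, ∃ v, v ≫ ψ = u) ∧ (∀ v : x ⟶ a, v ≫ ψ = 0 → v = 0) := by
  have z31 : δ ≫ i⟦(1 : ℤ)⟧' = 0 := comp_distTriang_mor_zero₃₁ _ hT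
  have z23' : p' ≫ δ' = 0 := comp_distTriang_mor_zero₂₃ _ hT'
  constructor
  · intro u
    obtain ⟨v₂, hv₂⟩ := hs2 (u ≫ p')
    have h0 : v₂ ≫ δ = 0 := by
      apply hi1'
      rw [assoc, c₃, ← assoc, hv₂, assoc, z23', comp_zero]
    obtain ⟨v, hv⟩ : ∃ v, v₂ = v ≫ p := co3 hT v₂ h0
    obtain ⟨w, hw⟩ : ∃ w, u - v ≫ ψ = w ≫ i' := co2 hT' (u - v ≫ ψ) (by
      rw [Preadditive.sub_comp, assoc, ← c₂, ← assoc, ← hv, hv₂, sub_self])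
    obtain ⟨w', rfl⟩ := hs1 w
    refine ⟨v + w' ≫ i, ?_⟩
    rw [Preadditive.add_comp, assoc, c₁, ← assoc, ← hw]
    abel
  · intro v hv
    have h1 : v ≫ p = 0 := hi2 _ (by rw [assoc, c₂, ← assoc, hv, zero_comp])
    obtain ⟨w, rfl⟩ : ∃ w, v = w ≫ i := co2 hT v h1
    obtain ⟨t, ht⟩ : ∃ t, (w ≫ ψ₁)⟦(1 : ℤ)⟧' = t ≫ δ' :=
      co1 hT' ((w ≫ ψ₁)⟦(1 : ℤ)⟧') (by
        rw [← Functor.map_comp, assoc, ← c₁, ← assoc, hv, Functor.map_zero])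
    obtain ⟨t', rfl⟩ := hs2' t
    have : w⟦(1 : ℤ)⟧' - t' ≫ δ = 0 := hi1'' _ (by
      rw [Preadditive.sub_comp, ← Functor.map_comp, ht, assoc, assoc, c₃, sub_self])
    apply (shiftFunctor D (1 : ℤ)).map_injective
    rw [Functor.map_comp, sub_eq_zero.1 this, assoc, z31, comp_zero, Functor.map_zero]

lemma zero_of_iso {x y F : D} (e : y ≅ x) (h : ∀ f : y ⟶ F, f = 0) (f : x ⟶ F) : f = 0 := by
  rw [← cancel_epi e.hom, h (e.hom ≫ f), comp_zero]

lemma zero_shift {x F : D} (h : ∀ f : x⟦(-1 : ℤ)⟧ ⟶ F, f = 0) (f : x ⟶ F⟦(1 : ℤ)⟧) : f = 0 := by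
  refine zero_of_iso (shiftNegShift x (1 : ℤ)) (fun k => ?_) f
  obtain ⟨k', rfl⟩ := (shiftFunctor D (1 : ℤ)).map_surjective k
  rw [h k', Functor.map_zero]

lemma decomp_ext (P Q : Set D) (hP1 : ∀ a ∈ P, a⟦(1 : ℤ)⟧ ∈ P) (hPm : ∀ a ∈ P, a⟦(-1 : ℤ)⟧ ∈ P)
    (horth : ∀ a ∈ P, ∀ b ∈ Q, ∀ f : a ⟶ b, f = 0)
    (hP : ext1 P ⊆ P) (hQ : ext1 Q ⊆ Q) : ext1 (ext1Pair Q P) ⊆ ext1Pair Q P := by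
  rintro d ⟨d₁, d₂, ⟨a₁, b₁, ha₁, hb₁, α₁, β₁, γ₁, h₁⟩, ⟨a₂, b₂, ha₂, hb₂, α₂, β₂, γ₂, h₂⟩,
    i, p, δ, hT⟩
  have zα₂ : α₂ ≫ β₂ = 0 := comp_distTriang_mor_zero₁₂ _ h₂
  -- sub
  have lift_post : ∀ {a d b : D} {α : a ⟶ d} {β : d ⟶ b} {γ : b ⟶ a⟦(1 : ℤ)⟧},
      Triangle.mk α β γ ∈ distTriang D → ∀ x : D, (∀ f : x ⟶ b, f = 0) →
      (∀ u : x ⟶ d, ∃ v, v ≫ α = u) ∧ (∀ v : x ⟶ a⟦(1 : ℤ)⟧, v ≫ α⟦(1 : ℤ)⟧' = 0 → v = 0) := by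
    intro a d b α β γ h x hx
    constructor
    · intro u
      obtain ⟨v, hv⟩ := co2 h u (hx _)
      exact ⟨v, hv.symm⟩
    · intro v hv
      obtain ⟨g, hg⟩ := co1 h v hv
      rw [hg, hx g]; simp
  have inj_post : ∀ {a d b : D} {α : a ⟶ d} {β : d ⟶ b} {γ : b ⟶ a⟦(1 : ℤ)⟧},
      Triangle.mk α β γ ∈ distTriang D → ∀ x : D, (∀ f : x⟦(1 : ℤ)⟧ ⟶ b, f = 0) →
      (∀ v : x ⟶ a, v ≫ α = 0 → v = 0) := by
    intro a d b α β γ h x hx v hv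
    apply (shiftFunctor D (1 : ℤ)).map_injective
    rw [Functor.map_zero]
    apply (lift_post h _ hx).2
    rw [← Functor.map_comp, hv, Functor.map_zero]
  have pre : ∀ {a d b : D} {α : a ⟶ d} {β : d ⟶ b} {γ : b ⟶ a⟦(1 : ℤ)⟧},
      Triangle.mk α β γ ∈ distTriang D → ∀ F : D, (∀ f : a ⟶ F, f = 0) →
      (∀ f : a⟦(1 : ℤ)⟧ ⟶ F, f = 0) →
      (∀ u : d ⟶ F, ∃ v, β ≫ v = u) ∧ (∀ v : b ⟶ F, β ≫ v = 0 → v = 0) ∧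
      (∀ u : d⟦(1 : ℤ)⟧ ⟶ F, ∃ v, β⟦(1 : ℤ)⟧' ≫ v = u) := by
    intro a d b α β γ h F hF hF1
    refine ⟨fun u => ?_, fun v hv => ?_, fun u => ?_⟩
    · obtain ⟨v, hv⟩ := yo2 h u (hF _)
      exact ⟨v, hv.symm⟩
    · obtain ⟨g, hg⟩ := yo3 h v hv
      rw [hg, hF1 g]; simp
    · obtain ⟨v, hv⟩ := yo5 h u (hF1 _)
      exact ⟨v, hv.symm⟩
  -- the connecting map on the `P` side
  have orth1 : ∀ x ∈ P, ∀ F : D, (∀ y ∈ P, ∀ f : y ⟶ F, f = 0) → ∀ f : x ⟶ F⟦(1 : ℤ)⟧, f = 0 :=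
    fun x hx F hF f => zero_shift (hF _ (hPm x hx)) f
  have hQorth : ∀ b ∈ Q, ∀ y ∈ P, ∀ f : y ⟶ b, f = 0 := fun b hb y hy f => horth y hy b hb f
  obtain ⟨k, hk⟩ : ∃ k : a₂ ⟶ a₁⟦(1 : ℤ)⟧, k ≫ α₁⟦(1 : ℤ)⟧' = α₂ ≫ δ := by
    obtain ⟨v, hv⟩ := co4 h₁ (α₂ ≫ δ) (orth1 _ ha₂ _ (hQorth _ hb₁) _)
    exact ⟨v, hv.symm⟩
  obtain ⟨l, hl⟩ : ∃ l : b₂ ⟶ b₁⟦(1 : ℤ)⟧, β₂ ≫ l = δ ≫ β₁⟦(1 : ℤ)⟧' := by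
    obtain ⟨l, hl⟩ := yo2 h₂ (δ ≫ β₁⟦(1 : ℤ)⟧')
      (orth1 _ ha₂ _ (hQorth _ hb₁) _)
    exact ⟨l, hl.symm⟩
  obtain ⟨a, ia, pa, hTa⟩ := distinguished_cocone_triangle₂ k
  obtain ⟨b, ib, pb, hTb⟩ := distinguished_cocone_triangle₂ l
  have ha : a ∈ P := hP ⟨a₁, a₂, ha₁, ha₂, _, _, _, hTa⟩
  have hb : b ∈ Q := hQ ⟨b₁, b₂, hb₁, hb₂, _, _, _, hTb⟩
  obtain ⟨ψ, hψ₁, hψ₂⟩ : ∃ ψ : a ⟶ d, ia ≫ ψ = α₁ ≫ i ∧ pa ≫ α₂ = ψ ≫ p :=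
    complete_distinguished_triangle_morphism₂ _ _ hTa hT α₁ α₂ hk
  obtain ⟨φ, hφ₁, hφ₂⟩ : ∃ φ : d ⟶ b, i ≫ φ = β₁ ≫ ib ∧ p ≫ β₂ = φ ≫ pb :=
    complete_distinguished_triangle_morphism₂ _ _ hT hTb β₁ β₂ hl.symm
  have hpost : ∀ x ∈ P, (∀ u : x ⟶ d, ∃ v, v ≫ ψ = u) ∧ (∀ v : x ⟶ a, v ≫ ψ = 0 → v = 0) :=
    fun x hx => five_post hTa hT hψ₁ hψ₂ hk
      (lift_post h₁ x (horth x hx _ hb₁)).1 (lift_post h₂ x (horth x hx _ hb₂)).1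
      (inj_post h₂ x (horth _ (hP1 x hx) _ hb₂))
      (lift_post h₁ x (horth x hx _ hb₁)).2
      (lift_post h₁ _ (horth _ (hP1 x hx) _ hb₁)).2
      (lift_post h₂ _ (horth _ (hP1 x hx) _ hb₂)).1
  obtain ⟨C, γ, ε, hC⟩ := distinguished_cocone_triangle ψ
  have hCorth : ∀ x ∈ P, ∀ f : x ⟶ C, f = 0 := by
    intro x hx
    refine zero_of_iso (shiftNegShift x (1 : ℤ)) (fun y => ?_)
    obtain ⟨w, hw⟩ := (shiftFunctor D (1 : ℤ)).map_surjective (y ≫ ε)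
    have z : ε ≫ ψ⟦(1 : ℤ)⟧' = 0 := comp_distTriang_mor_zero₃₁ _ hC
    have z' : ψ ≫ γ = 0 := comp_distTriang_mor_zero₁₂ _ hC
    have hw0 : w = 0 := (hpost _ (hPm x hx)).2 w (by
      apply (shiftFunctor D (1 : ℤ)).map_injective
      rw [Functor.map_comp, hw, assoc, z, comp_zero, Functor.map_zero])
    obtain ⟨u, rfl⟩ : ∃ u, y = u ≫ γ := co3 hC y (by
      rw [← hw, hw0, Functor.map_zero])
    obtain ⟨v, rfl⟩ := (hpost _ (hP1 _ (hPm x hx))).1 u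
    rw [assoc, z', comp_zero]
  have hpreC : ∀ F : D, (∀ x ∈ P, ∀ f : x ⟶ F, f = 0) →
      (∀ u : d ⟶ F, ∃ v, γ ≫ v = u) ∧ (∀ v : C ⟶ F, γ ≫ v = 0 → v = 0) := fun F hF =>
    ⟨(pre hC F (hF _ ha) (hF _ (hP1 _ ha))).1, (pre hC F (hF _ ha) (hF _ (hP1 _ ha))).2.1⟩
  have hpreb : ∀ F : D, (∀ x ∈ P, ∀ f : x ⟶ F, f = 0) →
      (∀ u : d ⟶ F, ∃ v, φ ≫ v = u) ∧ (∀ v : b ⟶ F, φ ≫ v = 0 → v = 0) := by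
    intro F hF
    have p1 := pre h₁ F (hF _ ha₁) (hF _ (hP1 _ ha₁))
    have p2 := pre h₂ F (hF _ ha₂) (hF _ (hP1 _ ha₂))
    have p3 := pre h₂ (F⟦(1 : ℤ)⟧) (orth1 _ ha₂ F hF) (orth1 _ (hP1 _ ha₂) F hF)
    exact five_pre hT hTb hφ₁ hφ₂ hl.symm p1.1 p1.2.1 p2.1 p2.2.1 p3.2.1 p1.2.2
  obtain ⟨q, hq⟩ := (hpreC b (hQorth b hb)).1 φ
  obtain ⟨r, hr⟩ := (hpreb C hCorth).1 γ
  have e : C ≅ b :=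
    { hom := q
      inv := r
      hom_inv_id := by
        rw [← sub_eq_zero]
        apply (hpreC C hCorth).2
        rw [Preadditive.comp_sub, ← assoc, hq, hr, comp_id, sub_self]
      inv_hom_id := by
        rw [← sub_eq_zero]
        apply (hpreb b (hQorth b hb)).2
        rw [Preadditive.comp_sub, ← assoc, hr, hq, comp_id, sub_self] }
  exact ⟨a, b, ha, hb, _, _, _, dist_iso₃ hC e⟩

section orth

variable [HasCoproducts.{v} D]

lemma compact_orth {a : D} (ha : IsCompactObj a) {I : Type v} (b : I → D)
    (h : ∀ i, ∀ f : a ⟶ b i, f = 0) (f : a ⟶ ∐ b) : f = 0 := by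
  classical
  unfold IsCompactObj at ha
  obtain ⟨s, rfl⟩ := (ha b).2 f
  have : s = 0 := DFinsupp.ext fun i => h i _
  rw [this, map_zero]

lemma orth_left (F : D) (S : Set D) (h : ∀ a ∈ S, ∀ f : a ⟶ F, f = 0) :
    ∀ a ∈ extInfty S, ∀ f : a ⟶ F, f = 0 := by
  refine extAll_subset (Q := {a | ∀ f : a ⟶ F, f = 0}) ?_ ?_
  · rintro d ⟨I, b, hb, ⟨e⟩⟩
    refine zero_of_iso e.symm fun f => ?_
    exact Sigma.hom_ext _ _ fun i => by rw [h _ (hb i) (Sigma.ι b i ≫ f), comp_zero]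
  · rintro d ⟨a, b, ha, hb, f, g, k, hT⟩ u
    obtain ⟨w, rfl⟩ : ∃ w, u = g ≫ w := yo2 hT u (ha _)
    rw [hb w, comp_zero]

lemma orth_right (a : D) (ha : IsCompactObj a) (S : Set D) (h : ∀ b ∈ S, ∀ f : a ⟶ b, f = 0) :
    ∀ b ∈ extInfty S, ∀ f : a ⟶ b, f = 0 := by
  refine extAll_subset (Q := {b | ∀ f : a ⟶ b, f = 0}) ?_ ?_
  · rintro d ⟨I, b, hb, ⟨e⟩⟩ f
    rw [← cancel_mono e.hom, zero_comp]
    exact compact_orth ha b (fun i => h _ (hb i)) _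
  · rintro d ⟨a, b, ha, hb, f, g, k, hT⟩ u
    obtain ⟨w, rfl⟩ : ∃ w, u = w ≫ f := co2 hT u (hb _)
    rw [ha w, zero_comp]

end orth

end Stmt7Aux

open Stmt7Aux in
/-- Let `(A, B)` be an m-structure on the subcategory generated by `H`, with `A`
consisting of compact objects (`A ⊥ B`, `A` and `B` triangulated subcategories, and
`H ⊆ Ext¹(B, A)`). Then `(Ext^∞(A), Ext^∞(B))` satisfies orthogonality, shift-invariance,
and decomposes `Ext^∞(H)`, i.e. forms an m-structure on `Ext^∞(H)`. -/
theorem stmt7 [HasCoproducts.{v} D] (A B H : Set D)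
    (hAshift : ∀ a ∈ A, a⟦(1 : ℤ)⟧ ∈ A ∧ a⟦(-1 : ℤ)⟧ ∈ A)
    (hBshift : ∀ b ∈ B, b⟦(1 : ℤ)⟧ ∈ B ∧ b⟦(-1 : ℤ)⟧ ∈ B)
    (hAtria : ext1 A ⊆ A) (hBtria : ext1 B ⊆ B)
    (hcompact : ∀ a ∈ A, IsCompactObj a)
    (horth : ∀ a ∈ A, ∀ b ∈ B, ∀ f : a ⟶ b, f = 0)
    (hdec : H ⊆ ext1Pair B A) :
    -- orthogonality
    (∀ a ∈ extInfty A, ∀ b ∈ extInfty B, ∀ f : a ⟶ b, f = 0) ∧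
    -- shift invariance
    (∀ a ∈ extInfty A, a⟦(1 : ℤ)⟧ ∈ extInfty A ∧ a⟦(-1 : ℤ)⟧ ∈ extInfty A) ∧
    (∀ b ∈ extInfty B, b⟦(1 : ℤ)⟧ ∈ extInfty B ∧ b⟦(-1 : ℤ)⟧ ∈ extInfty B) ∧
    -- decomposition of Ext^∞(H)
    (extInfty H ⊆ ext1Pair (extInfty B) (extInfty A)) := by
  have orth : ∀ a ∈ extInfty A, ∀ b ∈ extInfty B, ∀ f : a ⟶ b, f = 0 := fun a ha b hb =>
    orth_left b A (fun a' ha' => orth_right a' (hcompact a' ha') B (horth a' ha') b hb) a ha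
  have shA : ∀ n : ℤ, (∀ a ∈ A, a⟦n⟧ ∈ A) → ∀ a ∈ extInfty A, a⟦n⟧ ∈ extInfty A := fun n h =>
    extAll_shift n (coprodClosure_shift n h)
  have shB : ∀ n : ℤ, (∀ a ∈ B, a⟦n⟧ ∈ B) → ∀ a ∈ extInfty B, a⟦n⟧ ∈ extInfty B := fun n h =>
    extAll_shift n (coprodClosure_shift n h)
  have hA1 := shA 1 fun a ha => (hAshift a ha).1
  have hA2 := shA (-1) fun a ha => (hAshift a ha).2
  have hB1 := shB 1 fun a ha => (hBshift a ha).1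
  have hB2 := shB (-1) fun a ha => (hBshift a ha).2
  refine ⟨orth, fun a ha => ⟨hA1 a ha, hA2 a ha⟩, fun b hb => ⟨hB1 b hb, hB2 b hb⟩, ?_⟩
  obtain ⟨zA, hzA, hzA'⟩ := exists_zero_mem A
  obtain ⟨zB, hzB, hzB'⟩ := exists_zero_mem B
  refine extAll_subset ?_ (decomp_ext _ _ hA1 hA2 orth (ext1_extAll hzA hzA')
    (ext1_extAll hzB hzB'))
  rintro d ⟨I, h, hh, ⟨e⟩⟩
  refine ext1Pair_iso e.symm ?_
  choose a b ha hb f g k hT using fun i => hdec (hh i)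
  obtain ⟨g', k', hT'⟩ := coprod_dist a h b f g k hT
  exact ⟨∐ a, ∐ b, subset_extAll hzA hzA' ⟨I, a, ha, ⟨Iso.refl _⟩⟩,
    subset_extAll hzB hzB' ⟨I, b, hb, ⟨Iso.refl _⟩⟩, _, _, _, hT'⟩
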